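/- arXiv:2104.03461 — 2 statements merged into one kernel-verified Lean document; each statement's English description precedes it below -/
import Mathlib

section
/- Let f : [-1,1] → ℝ be Lipschitz continuous with Lipschitz constant λ (i.e. |f(x) − f(y)| ≤ λ|x − y| for all x, y ∈ [-1,1]). Let N be a positive integer divisible by 4 and let f̄_N(x) = Σ_{k=0}^{N} (b̂_N[k]/b̂_N[0]) · ⟨f, w·T̄_k⟩ · T̄_k(x) be the Jackson damped Chebyshev approximation of f. Then sup_{x ∈ [-1,1]} |f̄_N(x) − f(x)| ≤ 18λ/N. -/
open MeasureTheory

/-- The normalized Chebyshev polynomials of the first kind, as functions on `ℝ`: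
`T̄_0 = T_0 / √π` and `T̄_k = √(2/π) · T_k` for `k ≥ 1`. -/
noncomputable def Tbar (k : ℕ) (x : ℝ) : ℝ :=
  if k = 0 then ((Polynomial.Chebyshev.T ℝ 0).eval x) / Real.sqrt Real.pi
  else Real.sqrt (2 / Real.pi) * ((Polynomial.Chebyshev.T ℝ (k : ℤ)).eval x)

/-- The Chebyshev weight function `w(x) = 1/√(1 - x²)`. -/
noncomputable def wCheb (x : ℝ) : ℝ := 1 / Real.sqrt (1 - x ^ 2)

/-- The Jackson coefficients
`b̂_N[k] = Σ_{j = -N/2-1}^{N/2+1-k} (N/2+1-|j|)·(N/2+1-|j+k|)`. -/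
noncomputable def bhat (N k : ℕ) : ℝ :=
  ∑ j ∈ Finset.Icc (-(N : ℤ) / 2 - 1) ((N : ℤ) / 2 + 1 - (k : ℤ)),
    ((((N : ℤ) / 2 + 1 - |j|) * ((N : ℤ) / 2 + 1 - |j + (k : ℤ)|) : ℤ) : ℝ)

/-- The Chebyshev coefficient `⟨f, w·T̄_k⟩ = ∫_{-1}^1 f(x)·w(x)·T̄_k(x) dx`. -/
noncomputable def chebCoeff (f : ℝ → ℝ) (k : ℕ) : ℝ :=
  ∫ x in (-1 : ℝ)..1, f x * (wCheb x * Tbar k x)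

/-- The Jackson damped Chebyshev approximation
`f̄_N(x) = Σ_{k=0}^N (b̂_N[k]/b̂_N[0]) · ⟨f, w·T̄_k⟩ · T̄_k(x)`. -/
noncomputable def jacksonApprox (N : ℕ) (f : ℝ → ℝ) (x : ℝ) : ℝ :=
  ∑ k ∈ Finset.range (N + 1), (bhat N k / bhat N 0) * chebCoeff f k * Tbar k x

open Polynomial.Chebyshev in
lemma jk_chebCoeff (f : ℝ → ℝ) (k : ℕ) : chebCoeff f k = ∫ y, f y * Tbar k y ∂measureT := by
  rw [integral_measureT, chebCoeff]
  refine intervalIntegral.integral_congr fun x _ => ?_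
  simp only [wCheb, Real.sqrt_inv, one_div]
  ring

lemma jk_cont (k : ℕ) : Continuous (Tbar k) := by
  unfold Tbar
  split_ifs <;> fun_prop

lemma jk_Tbar_zero (x : ℝ) : Tbar 0 x = 1 / √Real.pi := by
  simp [Tbar]

lemma jk_Tbar_pos (k : ℕ) (hk : k ≠ 0) (x : ℝ) :
    Tbar k x = √(2 / Real.pi) * ((Polynomial.Chebyshev.T ℝ (k : ℤ)).eval x) := by
  simp [Tbar, hk]

open Polynomial.Chebyshev in
lemma jk_orth (j k : ℕ) : ∫ y, Tbar j y * Tbar k y ∂measureT = if j = k then 1 else 0 := by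
  have key : ∀ k : ℕ, ∃ c : ℝ, ∀ y, Tbar k y = c * (T ℝ (k : ℤ)).eval y := by
    intro k
    by_cases hk : k = 0
    · subst hk
      exact ⟨1 / √Real.pi, fun y => by simp [Tbar]⟩
    · exact ⟨_, fun y => jk_Tbar_pos k hk y⟩
  split_ifs with h
  · subst h
    by_cases hk : j = 0
    · subst hk
      have : ∀ y, Tbar 0 y * Tbar 0 y
          = (1 / Real.pi) * ((T ℝ 0).eval y * (T ℝ 0).eval y) := by
        intro y
        rw [jk_Tbar_zero]
        simp only [T_zero, Polynomial.eval_one]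
        rw [div_mul_div_comm, Real.mul_self_sqrt Real.pi_pos.le]
        ring
      simp_rw [this]
      rw [integral_const_mul, integral_eval_T_real_mul_self_measureT_zero]
      field_simp
    · have : ∀ y, Tbar j y * Tbar j y
          = (2 / Real.pi) * ((T ℝ (j : ℤ)).eval y * (T ℝ (j : ℤ)).eval y) := by
        intro y
        rw [jk_Tbar_pos j hk, mul_mul_mul_comm, Real.mul_self_sqrt (by positivity)]
      simp_rw [this]
      rw [integral_const_mul, integral_T_real_mul_self_measureT_of_ne_zero hk]
      field_simp
  · obtain ⟨c, hc⟩ := key j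
    obtain ⟨d, hd⟩ := key k
    have : ∀ y, Tbar j y * Tbar k y
        = (c * d) * ((T ℝ (j : ℤ)).eval y * (T ℝ (k : ℤ)).eval y) := by
      intro y; rw [hc, hd]; ring
    simp_rw [this]
    rw [integral_const_mul, integral_eval_T_real_mul_eval_T_real_measureT_of_ne h, mul_zero]

noncomputable def jkK (N : ℕ) (x y : ℝ) : ℝ :=
  ∑ k ∈ Finset.range (N + 1), (bhat N k / bhat N 0) * Tbar k y * Tbar k x

lemma jkK_cont (N : ℕ) (x : ℝ) : Continuous (jkK N x) := by
  unfold jkK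
  exact continuous_finsetSum _ fun k _ => (continuous_const.mul (jk_cont k)).mul continuous_const

open Polynomial.Chebyshev in
lemma jk_int (N : ℕ) (f : ℝ → ℝ) (hf : ContinuousOn f (Set.Icc (-1) 1)) (x : ℝ) :
    jacksonApprox N f x = ∫ y, f y * jkK N x y ∂measureT := by
  unfold jacksonApprox jkK
  simp_rw [Finset.mul_sum]
  rw [integral_finsetSum]
  · refine Finset.sum_congr rfl fun k _ => ?_
    rw [jk_chebCoeff, ← integral_const_mul, ← integral_mul_const]
    congr 1; ext y; ring
  · intro k _
    apply integrable_measureT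
    exact hf.mul ((continuous_const.mul (jk_cont k)).mul continuous_const).continuousOn

lemma jk_app_Tbar (N j : ℕ) (hj : j ≤ N) (x : ℝ) :
    jacksonApprox N (Tbar j) x = (bhat N j / bhat N 0) * Tbar j x := by
  unfold jacksonApprox
  simp_rw [jk_chebCoeff, jk_orth]
  rw [Finset.sum_eq_single j]
  · simp
  · intro b _ hb; simp [hb.symm]
  · intro h; exfalso; apply h; simp; omega

noncomputable def jkd (N i : ℕ) : ℝ := ((((N : ℤ) / 2 + 1 - |(i : ℤ) + 1 - ((N : ℤ) / 2 + 1)|) : ℤ) : ℝ)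

lemma jk_bhat (N k : ℕ) (hN4 : 4 ∣ N) (hk : k ≤ N) :
    bhat N k = ∑ i ∈ Finset.range (N + 1 - k), jkd N i * jkd N (i + k) := by
  unfold bhat jkd
  obtain ⟨t, rfl⟩ := hN4
  have e : ((4 * t : ℕ) : ℤ) / 2 = 2 * t := by omega
  have e' : -((4 * t : ℕ) : ℤ) / 2 = - (2 * t) := by omega
  rw [e, e']
  symm
  trans ∑ j ∈ Finset.Icc (-(2 * (t : ℤ))) (2 * t - k),
    (((2 * (t : ℤ) + 1 - |j|) * (2 * (t : ℤ) + 1 - |j + (k : ℤ)|) : ℤ) : ℝ)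
  · refine Finset.sum_nbij' (fun i => (i : ℤ) - 2 * t) (fun j => (j + 2 * t).toNat) ?_ ?_ ?_ ?_ ?_
    · intro i hi; simp at hi ⊢; omega
    · intro j hj; simp at hj ⊢; omega
    · intro i hi; simp
    · intro j hj; simp at hj ⊢; omega
    · intro i hi
      rw [← Int.cast_mul]
      have a1 : (i : ℤ) + 1 - (2 * t + 1) = (i : ℤ) - 2 * t := by ring
      have a2 : ((i + k : ℕ) : ℤ) + 1 - (2 * t + 1) = (i : ℤ) - 2 * t + k := by push_cast; ring
      rw [a1, a2]
  · apply Finset.sum_subset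
    · intro j hj; simp at hj ⊢; omega
    · intro j hj hj'
      simp only [Finset.mem_Icc] at hj hj'
      have : j = -(2 * t) - 1 ∨ j = 2 * t + 1 - k := by omega
      rcases this with rfl | rfl
      · rw [show |(-(2 * (t : ℤ)) - 1)| = 2 * t + 1 by rw [abs_of_nonpos] <;> omega]; simp
      · rw [show |(2 * (t : ℤ) + 1 - k + k)| = 2 * t + 1 by rw [abs_of_nonneg] <;> omega]; simp

lemma jk_group (d : ℕ → ℝ) (u : ℝ) (n : ℕ) :
    ∑ k ∈ Finset.range n, (if k = 0 then 1 else 2) *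
        ((∑ i ∈ Finset.range (n - k), d i * d (i + k)) * Real.cos (k * u))
      = (∑ i ∈ Finset.range n, d i * Real.cos (i * u)) ^ 2
        + (∑ i ∈ Finset.range n, d i * Real.sin (i * u)) ^ 2 := by
  induction n with
  | zero => simp
  | succ n ih =>
    have h1 : ∑ k ∈ Finset.range (n + 1), (if k = 0 then (1 : ℝ) else 2) *
        ((∑ i ∈ Finset.range (n + 1 - k), d i * d (i + k)) * Real.cos (k * u))
        = ∑ k ∈ Finset.range n, (if k = 0 then (1 : ℝ) else 2) *
        ((∑ i ∈ Finset.range (n - k), d i * d (i + k)) * Real.cos (k * u))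
        + ∑ k ∈ Finset.range (n + 1), (if k = 0 then (1 : ℝ) else 2) *
          (d (n - k) * d n * Real.cos (k * u)) := by
      have : ∑ k ∈ Finset.range n, (if k = 0 then (1 : ℝ) else 2) *
        ((∑ i ∈ Finset.range (n - k), d i * d (i + k)) * Real.cos (k * u))
        = ∑ k ∈ Finset.range (n + 1), (if k = 0 then (1 : ℝ) else 2) *
        ((∑ i ∈ Finset.range (n - k), d i * d (i + k)) * Real.cos (k * u)) := by
        rw [Finset.sum_range_succ]; simp
      rw [this, ← Finset.sum_add_distrib]
      refine Finset.sum_congr rfl fun k hk => ?_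
      have hk' : k ≤ n := by simp at hk; omega
      rw [show n + 1 - k = (n - k) + 1 by omega, Finset.sum_range_succ,
        show n - k + k = n by omega]
      ring
    have h2 : ∑ k ∈ Finset.range (n + 1), (if k = 0 then (1 : ℝ) else 2) *
          (d (n - k) * d n * Real.cos (k * u))
        = d n ^ 2 + 2 * d n * ∑ i ∈ Finset.range n, d i * Real.cos (n * u - i * u) := by
      rw [Finset.sum_range_succ', ← Finset.sum_range_reflect (fun i => d i * Real.cos (n * u - i * u)),
        Finset.mul_sum, add_comm]
      congr 1
      · simp; ring
      · refine Finset.sum_congr rfl fun k hk => ?_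
        have hk' : k < n := by simpa using hk
        rw [show n - 1 - k = n - (k + 1) by omega, Nat.cast_sub (by omega)]
        simp only [Nat.add_eq_zero_iff, one_ne_zero, and_false, if_false]
        rw [show (n : ℝ) * u - ((n : ℝ) - ((k + 1 : ℕ) : ℝ)) * u = ((k + 1 : ℕ) : ℝ) * u by ring]
        ring
    rw [h1, ih, h2, Finset.sum_range_succ, Finset.sum_range_succ]
    simp_rw [Real.cos_sub]
    have h3 : ∑ i ∈ Finset.range n, d i * (Real.cos (n * u) * Real.cos (i * u)
          + Real.sin (n * u) * Real.sin (i * u))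
        = Real.cos (n * u) * (∑ i ∈ Finset.range n, d i * Real.cos (i * u))
        + Real.sin (n * u) * (∑ i ∈ Finset.range n, d i * Real.sin (i * u)) := by
      rw [Finset.mul_sum, Finset.mul_sum, ← Finset.sum_add_distrib]
      refine Finset.sum_congr rfl fun k hk => by ring
    rw [h3]
    linear_combination (-(d n ^ 2)) * Real.sin_sq_add_cos_sq (n * u)

lemma jk_b0_b1 (N : ℕ) (hN4 : 4 ∣ N) (hN : 0 < N) :
    bhat N 0 = (2 * ((N : ℝ) / 2 + 1) ^ 3 + ((N : ℝ) / 2 + 1)) / 3 ∧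
    bhat N 0 - bhat N 1 = (N : ℝ) / 2 + 1 := by
  rw [jk_bhat N 0 hN4 (by omega), jk_bhat N 1 hN4 (by omega)]
  obtain ⟨t, rfl⟩ := hN4
  have e : ((4 * t : ℕ) : ℤ) / 2 = 2 * t := by omega
  have hA : ∀ i ≤ 2 * t, jkd (4 * t) i = i + 1 := by
    intro i hi
    unfold jkd
    rw [e, abs_of_nonpos (by omega)]; push_cast; ring
  have hB : ∀ i ≤ 2 * t, jkd (4 * t) (2 * t + i) = 2 * t + 1 - i := by
    intro i hi
    unfold jkd
    rw [e, abs_of_nonneg (by omega)]; push_cast; ring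
  have s1 : ∀ n : ℕ, ∑ i ∈ Finset.range n, ((i : ℝ) + 1) * (i + 1) = n * (n + 1) * (2 * n + 1) / 6 := by
    intro n
    induction n with
    | zero => simp
    | succ n ih => rw [Finset.sum_range_succ, ih]; push_cast; ring
  have s2 : ∀ n : ℕ, ∑ i ∈ Finset.range n, ((i : ℝ) + 1) * (i + 2) = n * (n + 1) * (n + 2) / 3 := by
    intro n
    induction n with
    | zero => simp
    | succ n ih => rw [Finset.sum_range_succ, ih]; push_cast; ring
  have s3 : ∀ (a : ℝ) (n : ℕ), ∑ i ∈ Finset.range n, (a - i) * (a - i) =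
      n * a ^ 2 - a * n * (n - 1) + (n - 1) * n * (2 * n - 1) / 6 := by
    intro a n
    induction n with
    | zero => simp
    | succ n ih => rw [Finset.sum_range_succ, ih]; push_cast; ring
  have s4 : ∀ (a : ℝ) (n : ℕ), ∑ i ∈ Finset.range n, (a - i) * (a - i - 1) =
      n * a ^ 2 - a * n * (n - 1) + (n - 1) * n * (2 * n - 1) / 6 - n * a + n * (n - 1) / 2:= by
    intro a n
    induction n with
    | zero => simp
    | succ n ih => rw [Finset.sum_range_succ, ih]; push_cast; ring
  have b0 : ∑ i ∈ Finset.range (4 * t + 1 - 0), jkd (4 * t) i * jkd (4 * t) (i + 0)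
      = ∑ i ∈ Finset.range (2 * t), ((i : ℝ) + 1) * (i + 1)
       + ∑ i ∈ Finset.range (2 * t + 1), ((2 * t + 1 : ℝ) - i) * ((2 * t + 1 : ℝ) - i) := by
    rw [show 4 * t + 1 - 0 = 2 * t + (2 * t + 1) by omega, Finset.sum_range_add]
    congr 1
    · refine Finset.sum_congr rfl fun i hi => ?_
      simp at hi
      rw [add_zero, hA i (by omega)]
    · refine Finset.sum_congr rfl fun i hi => ?_
      simp at hi
      rw [add_zero, hB i (by omega)]
  have b1 : ∑ i ∈ Finset.range (4 * t + 1 - 1), jkd (4 * t) i * jkd (4 * t) (i + 1)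
      = ∑ i ∈ Finset.range (2 * t), ((i : ℝ) + 1) * (i + 2)
       + ∑ i ∈ Finset.range (2 * t), ((2 * t + 1 : ℝ) - i) * ((2 * t + 1 : ℝ) - i - 1) := by
    rw [show 4 * t + 1 - 1 = 2 * t + (2 * t) by omega, Finset.sum_range_add]
    congr 1
    · refine Finset.sum_congr rfl fun i hi => ?_
      simp at hi
      rw [hA i (by omega), hA (i + 1) (by omega)]; push_cast; ring
    · refine Finset.sum_congr rfl fun i hi => ?_
      simp at hi
      rw [add_assoc, hB i (by omega), hB (i + 1) (by omega)]; push_cast; ring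
  rw [b0, b1, s1, s2, s3, s4]
  push_cast
  constructor <;> ring

lemma jk_b0_pos (N : ℕ) (hN4 : 4 ∣ N) (hN : 0 < N) : 0 < bhat N 0 := by
  rw [(jk_b0_b1 N hN4 hN).1]; positivity

lemma jkK_nonneg (N : ℕ) (hN4 : 4 ∣ N) (hN : 0 < N) (x y : ℝ) (hx : x ∈ Set.Icc (-1 : ℝ) 1)
    (hy : y ∈ Set.Icc (-1 : ℝ) 1) : 0 ≤ jkK N x y := by
  have hb := jk_b0_pos N hN4 hN
  have key : jkK N x y = (1 / (2 * Real.pi * bhat N 0)) *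
     (∑ k ∈ Finset.range (N + 1), (if k = 0 then 1 else 2) *
        ((∑ i ∈ Finset.range (N + 1 - k), jkd N i * jkd N (i + k))
          * Real.cos (k * (Real.arccos x - Real.arccos y)))
      + ∑ k ∈ Finset.range (N + 1), (if k = 0 then 1 else 2) *
        ((∑ i ∈ Finset.range (N + 1 - k), jkd N i * jkd N (i + k))
          * Real.cos (k * (Real.arccos x + Real.arccos y)))) := by
    unfold jkK
    rw [← Finset.sum_add_distrib, Finset.mul_sum]
    refine Finset.sum_congr rfl fun k hk => ?_
    rw [← jk_bhat N k hN4 (by simp at hk; omega)]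
    have hpi := Real.pi_pos
    have hs : √Real.pi ^ 2 = Real.pi := Real.sq_sqrt hpi.le
    have hs2 : √(2 / Real.pi) ^ 2 = 2 / Real.pi := Real.sq_sqrt (by positivity)
    split_ifs with h
    · subst h
      rw [jk_Tbar_zero, jk_Tbar_zero, mul_assoc, div_mul_div_comm, ← sq √Real.pi, hs]
      simp
      field_simp
      ring
    · rw [jk_Tbar_pos k h, jk_Tbar_pos k h]
      have ex : (Polynomial.Chebyshev.T ℝ (k : ℤ)).eval x = Real.cos (k * Real.arccos x) := by
        conv_lhs => rw [← Real.cos_arccos hx.1 hx.2]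
        rw [Polynomial.Chebyshev.T_real_cos]; simp
      have ey : (Polynomial.Chebyshev.T ℝ (k : ℤ)).eval y = Real.cos (k * Real.arccos y) := by
        conv_lhs => rw [← Real.cos_arccos hy.1 hy.2]
        rw [Polynomial.Chebyshev.T_real_cos]; simp
      rw [ex, ey, mul_add (k : ℝ), mul_sub (k : ℝ), Real.cos_add, Real.cos_sub]
      have : ∀ A B C D E : ℝ, A / B * (√(2 / Real.pi) * C) * (√(2 / Real.pi) * D)
          = A / B * √(2 / Real.pi) ^ 2 * (C * D) := by intros; ring
      rw [this _ _ _ _ 0, hs2]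
      field_simp
      ring
  rw [key, jk_group, jk_group]
  positivity

open Polynomial.Chebyshev in
lemma jk_quad (N : ℕ) (hN4 : 4 ∣ N) (hN : 0 < N) (x a b c : ℝ) :
    ∫ y, (a + b * y + c * y ^ 2) * jkK N x y ∂measureT
      = a + b * (bhat N 1 / bhat N 0) * x
        + c * (1 + (bhat N 2 / bhat N 0) * (2 * x ^ 2 - 1)) / 2 := by
  have hb := jk_b0_pos N hN4 hN
  have hpi := Real.pi_pos
  have h0 := jk_app_Tbar N 0 (by omega) x
  have h1 := jk_app_Tbar N 1 (by omega) x
  have h2 := jk_app_Tbar N 2 (by have := Nat.le_of_dvd hN hN4; omega) x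
  rw [jk_int N _ (jk_cont _).continuousOn] at h0 h1 h2
  have hs : √Real.pi ≠ 0 := by positivity
  have hs2 : √(2 / Real.pi) ≠ 0 := by positivity
  have t1 : ∀ y, Tbar 1 y = √(2 / Real.pi) * y := by
    intro y; rw [jk_Tbar_pos 1 (by norm_num)]; simp
  have t2 : ∀ y, Tbar 2 y = √(2 / Real.pi) * (2 * y ^ 2 - 1) := by
    intro y; rw [jk_Tbar_pos 2 (by norm_num)]; simp [T_two]
  have e : ∀ y, (a + b * y + c * y ^ 2) * jkK N x y
      = (a + c / 2) * √Real.pi * (Tbar 0 y * jkK N x y)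
        + b / √(2 / Real.pi) * (Tbar 1 y * jkK N x y)
        + c / 2 / √(2 / Real.pi) * (Tbar 2 y * jkK N x y) := by
    intro y
    rw [jk_Tbar_zero, t1, t2]
    field_simp
    ring
  have I : ∀ k, ∀ r : ℝ, Integrable (fun y => r * (Tbar k y * jkK N x y)) measureT := fun k r =>
    integrable_measureT (continuous_const.mul ((jk_cont k).mul (jkK_cont N x))).continuousOn
  simp_rw [e]
  rw [integral_add (by exact (I _ _).add (I _ _)) (I _ _), integral_add (I _ _) (I _ _),
    integral_const_mul, integral_const_mul, integral_const_mul, h0, h1, h2, jk_Tbar_zero, t1, t2]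
  field_simp
  ring

open Polynomial.Chebyshev in
lemma jk_ae : ∀ᵐ y ∂measureT, y ∈ Set.Icc (-1 : ℝ) 1 := by
  unfold measureT
  filter_upwards [ae_restrict_mem measurableSet_Ioc] with y hy
  exact ⟨hy.1.le, hy.2⟩

open Polynomial.Chebyshev in
lemma jk_rho2 (N : ℕ) (hN4 : 4 ∣ N) (hN : 0 < N) :
    0 ≤ 1 - bhat N 2 / bhat N 0 ∧
    1 - bhat N 2 / bhat N 0 ≤ 4 * (1 - bhat N 1 / bhat N 0) := by
  have q1 := jk_quad N hN4 hN 1 2 (-4) 2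
  have q2 := jk_quad N hN4 hN 1 1 0 (-1)
  have p1 : 0 ≤ ∫ y, ((2:ℝ) + (-4) * y + 2 * y ^ 2) * jkK N 1 y ∂measureT := by
    apply integral_nonneg_of_ae
    filter_upwards [jk_ae] with y hy
    exact mul_nonneg (by nlinarith [sq_nonneg (y - 1)]) (jkK_nonneg N hN4 hN 1 y (by simp) hy)
  have p2 : 0 ≤ ∫ y, ((1:ℝ) + 0 * y + (-1) * y ^ 2) * jkK N 1 y ∂measureT := by
    apply integral_nonneg_of_ae
    filter_upwards [jk_ae] with y hy
    exact mul_nonneg (by nlinarith [hy.1, hy.2]) (jkK_nonneg N hN4 hN 1 y (by simp) hy)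
  rw [q1] at p1
  rw [q2] at p2
  constructor <;> linarith

/-- **Jackson's theorem for algebraic polynomials.**  If `f : [-1,1] → ℝ` is
`λ`-Lipschitz and `N` is a positive multiple of `4`, then the Jackson damped Chebyshev
approximation `f̄_N` satisfies `‖f̄_N - f‖_∞ ≤ 18λ/N` on `[-1,1]`. -/
theorem jackson_damped_chebyshev_uniform_bound
    (f : ℝ → ℝ) (lam : ℝ)
    (hf : ∀ x ∈ Set.Icc (-1 : ℝ) 1, ∀ y ∈ Set.Icc (-1 : ℝ) 1, |f x - f y| ≤ lam * |x - y|)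
    (N : ℕ) (hNpos : 0 < N) (hN4 : 4 ∣ N) :
    ∀ x ∈ Set.Icc (-1 : ℝ) 1, |jacksonApprox N f x - f x| ≤ 18 * lam / N := by
  intro x hx
  have hlam : 0 ≤ lam := by
    have := hf 0 (by simp) 1 (by simp)
    simp at this
    exact (abs_nonneg _).trans this
  have hNr : (0 : ℝ) < N := by exact_mod_cast hNpos
  have hc : ContinuousOn f (Set.Icc (-1) 1) := by
    have : LipschitzOnWith ⟨lam, hlam⟩ f (Set.Icc (-1) 1) := by
      apply LipschitzOnWith.of_dist_le_mul
      intro a ha b hb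
      rw [Real.dist_eq, Real.dist_eq]
      exact hf a ha b hb
    exact this.continuousOn
  have hK := jkK_cont N x
  have h1 : ∫ y, f x * jkK N x y ∂Polynomial.Chebyshev.measureT = f x := by
    have := jk_quad N hN4 hNpos x (f x) 0 0
    simpa using this
  have hI : ∀ g : ℝ → ℝ, ContinuousOn g (Set.Icc (-1) 1) →
      Integrable (fun y => g y * jkK N x y) Polynomial.Chebyshev.measureT := fun g hg =>
    Polynomial.Chebyshev.integrable_measureT (hg.mul hK.continuousOn)
  rw [jk_int N f hc]
  nth_rewrite 1 [← h1]
  rw [← integral_sub (hI f hc) (hI _ continuousOn_const)]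
  have step : |∫ y, (f y * jkK N x y - f x * jkK N x y) ∂Polynomial.Chebyshev.measureT| ≤
      ∫ y, ((lam / 2 * (N * x ^ 2 + 1 / N)) + (-(lam * N * x)) * y + (lam / 2 * N) * y ^ 2)
        * jkK N x y ∂Polynomial.Chebyshev.measureT := by
    rw [← Real.norm_eq_abs]
    apply norm_integral_le_of_norm_le (hI _ (by fun_prop))
    filter_upwards [jk_ae] with y hy
    have k0 := jkK_nonneg N hN4 hNpos x y hx hy
    rw [← sub_mul, norm_mul, Real.norm_eq_abs, Real.norm_eq_abs, abs_of_nonneg k0]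
    apply mul_le_mul_of_nonneg_right _ k0
    refine (hf y hy x hx).trans ?_
    have am : |y - x| ≤ (N * (y - x) ^ 2 + 1 / N) / 2 := by
      have : 0 ≤ (N * |y - x| - 1) ^ 2 / N := by positivity
      have e : (N * |y - x| - 1) ^ 2 / N = N * |y - x| ^ 2 - 2 * |y - x| + 1 / N := by
        field_simp
        ring
      rw [e, sq_abs] at this
      linarith
    calc lam * |y - x| ≤ lam * ((N * (y - x) ^ 2 + 1 / N) / 2) :=
          mul_le_mul_of_nonneg_left am hlam
      _ = _ := by ring
  refine step.trans ?_
  rw [jk_quad N hN4 hNpos]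
  obtain ⟨r0, r1⟩ := jk_rho2 N hN4 hNpos
  have hb := jk_b0_pos N hN4 hNpos
  obtain ⟨hb0, hb1⟩ := jk_b0_b1 N hN4 hNpos
  have hr : 1 - bhat N 1 / bhat N 0 ≤ 6 / N ^ 2 := by
    rw [one_sub_div hb.ne', hb1, hb0, div_le_div_iff₀ (by positivity) (by positivity)]
    nlinarith [hNr, pow_pos hNr 2, pow_pos hNr 3]
  set p := bhat N 1 / bhat N 0
  set q := bhat N 2 / bhat N 0
  have hx2 : x ^ 2 ≤ 1 := by nlinarith [hx.1, hx.2]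
  have hS : (1 - q) * (1 / 2 - x ^ 2) + 2 * x ^ 2 * (1 - p) ≤ 12 / N ^ 2 := by
    have : (1 - q) * (1 / 2 - x ^ 2) + 2 * x ^ 2 * (1 - p) ≤ 2 * (1 - p) := by
      nlinarith [mul_nonneg (sub_nonneg.2 hx2) (sub_nonneg.2 r1), mul_nonneg (sq_nonneg x) r0]
    have e : (12 : ℝ) / N ^ 2 = 2 * (6 / N ^ 2) := by ring
    linarith
  have fin : lam / 2 * (N * ((1 - q) * (1 / 2 - x ^ 2) + 2 * x ^ 2 * (1 - p)) + 1 / N)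
      ≤ lam / 2 * (N * (12 / N ^ 2) + 1 / N) := by gcongr
  calc _ = lam / 2 * (N * ((1 - q) * (1 / 2 - x ^ 2) + 2 * x ^ 2 * (1 - p)) + 1 / N) := by ring
    _ ≤ _ := fin
    _ = 13 / 2 * lam / N := by field_simp; norm_num
    _ ≤ 18 * lam / N := by gcongr; norm_num
end

section
/- Let λ_1, …, λ_n ∈ [-1,1], let ε ∈ (0,1), and let N be a positive integer divisible by 4 with N ≥ 18/ε. For k = 1,…,N set τ_k = (1/n)·Σ_{i=1}^{n} T̄_k(λ_i), and let τ̃_0 = 1/√π and τ̃_1,…,τ̃_N be real numbers with |τ̃_k − τ_k| ≤ 1/N² for all k = 1,…,N. Define s̃_N(x) = w(x)·Σ_{k=0}^{N} (b̂_N[k]/b̂_N[0]) · τ̃_k · T̄_k(x) and q(x) = (s̃_N(x) + w(x)·√2/(N√π)) / (1 + √(2π)/N). Then: (i) q(x) ≥ 0 for all x ∈ (−1,1); (ii) ∫_{−1}^{1} q(x) dx = 1; and (iii) for every 1-Lipschitz function f : [-1,1] → ℝ, one has |(1/n)·Σ_{i=1}^{n} f(λ_i) − ∫_{−1}^{1}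 f(x) q(x) dx| ≤ 2ε. -/
open MeasureTheory

/-- The `k`-th normalized Chebyshev moment `τ_k = (1/n)·Σ_i T̄_k(λ_i)` of the
spectral density of eigenvalues `λ_1, …, λ_n`. -/
noncomputable def chebMoment (n : ℕ) (lam : Fin n → ℝ) (k : ℕ) : ℝ :=
  (1 / (n : ℝ)) * ∑ i, Tbar k (lam i)

/-- The (un-normalized) density built from approximate Chebyshev moments `τ̃`:
`s̃_N(x) = w(x)·Σ_{k=0}^N (b̂_N[k]/b̂_N[0]) · τ̃_k · T̄_k(x)`. -/
noncomputable def sTilde (N : ℕ) (tauT : ℕ → ℝ) (x : ℝ) : ℝ :=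
  wCheb x * ∑ k ∈ Finset.range (N + 1), (bhat N k / bhat N 0) * tauT k * Tbar k x

/-- The density output by the full Jackson damped kernel polynomial method:
`q(x) = (s̃_N(x) + w(x)·√2/(N·√π)) / (1 + √(2π)/N)`. -/
noncomputable def kpmDensityApprox (N : ℕ) (tauT : ℕ → ℝ) (x : ℝ) : ℝ :=
  (sTilde N tauT x + wCheb x * Real.sqrt 2 / (N * Real.sqrt Real.pi)) /
    (1 + Real.sqrt (2 * Real.pi) / N)


namespace KPM

noncomputable def tri (h : ℕ) (j : ℤ) : ℝ := ((max 0 ((h : ℤ) + 1 - |j|) : ℤ) : ℝ)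

noncomputable def B (h : ℕ) (k : ℤ) : ℝ := ∑' j : ℤ, tri h j * tri h (j + k)

lemma tri_nonneg (h : ℕ) (j : ℤ) : 0 ≤ tri h j := by
  unfold tri; exact_mod_cast le_max_left _ _

lemma tri_zero (h : ℕ) (j : ℤ) (hj : j ∉ Finset.Icc (-(h : ℤ)) h) : tri h j = 0 := by
  unfold tri
  have : max 0 ((h : ℤ) + 1 - |j|) = 0 := by
    rw [Finset.mem_Icc] at hj
    grind
  rw [this]; simp

lemma summable_tri (h : ℕ) (g : ℤ → ℝ) : Summable (fun j => tri h j * g j) :=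
  summable_of_ne_finset_zero (s := Finset.Icc (-(h : ℤ)) h) (fun j hj => by
    rw [tri_zero h j hj, zero_mul])

lemma B_eq_sum (h : ℕ) (k : ℤ) (s : Finset ℤ)
    (hs : ∀ j ∈ Finset.Icc (-(h : ℤ)) h, j + k ∈ Finset.Icc (-(h : ℤ)) h → j ∈ s) :
    B h k = ∑ j ∈ s, tri h j * tri h (j + k) := by
  unfold B
  refine tsum_eq_sum (fun j hj => ?_)
  by_cases h1 : j ∈ Finset.Icc (-(h : ℤ)) h
  · have h2 : j + k ∉ Finset.Icc (-(h : ℤ)) h := fun h2 => hj (hs j h1 h2)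
    rw [tri_zero h _ h2, mul_zero]
  · rw [tri_zero h _ h1, zero_mul]

lemma B_neg (h : ℕ) (k : ℤ) : B h (-k) = B h k := by
  unfold B
  rw [← (Equiv.addRight k).tsum_eq (fun j => tri h j * tri h (j + -k))]
  refine tsum_congr (fun j => ?_)
  simp [mul_comm]

lemma B_nonneg (h : ℕ) (k : ℤ) : 0 ≤ B h k :=
  tsum_nonneg (fun j => mul_nonneg (tri_nonneg _ _) (tri_nonneg _ _))

lemma bhat_eq (h k : ℕ) (hk : k ≤ 2 * h) : bhat (2 * h) k = B h k := by
  rw [B_eq_sum h k (Finset.Icc (-((2 * h : ℕ) : ℤ) / 2 - 1) (((2 * h : ℕ) : ℤ) / 2 + 1 - (k : ℤ)))]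
  · unfold bhat
    refine Finset.sum_congr rfl (fun j hj => ?_)
    rw [Finset.mem_Icc] at hj
    unfold tri
    rw [← Int.cast_mul]
    congr 2
    · grind
    · grind
  · intro j h1 h2
    rw [Finset.mem_Icc] at *
    grind

lemma B_diff (h : ℕ) (k : ℤ) : 2 * (B h 0 - B h k) = ∑' j : ℤ, (tri h j - tri h (j + k)) ^ 2 := by
  have s1 := summable_tri h (fun j => tri h j)
  have s2 := summable_tri h (fun j => tri h (j + k))
  have s3 : Summable (fun j => tri h (j + k) * tri h (j + k)) :=
    (Equiv.addRight k).summable_iff.mpr s1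
  have e3 : ∑' j, tri h (j + k) * tri h (j + k) = B h 0 := by
    unfold B
    rw [← (Equiv.addRight k).tsum_eq (fun j => tri h j * tri h (j + 0))]
    simp
  have : (fun j => (tri h j - tri h (j + k)) ^ 2) = fun j =>
      (tri h j * tri h j + tri h (j + k) * tri h (j + k)) - 2 * (tri h j * tri h (j + k)) := by
    funext j; ring
  rw [this, (s1.add s3).tsum_sub (s2.mul_left 2), s1.tsum_add s3, e3, tsum_mul_left]
  simp only [B, add_zero]
  ring

lemma B_le (h : ℕ) (k : ℤ) : B h k ≤ B h 0 := by
  have := B_diff h k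
  have h2 : 0 ≤ ∑' j : ℤ, (tri h j - tri h (j + k)) ^ 2 := tsum_nonneg (fun j => sq_nonneg _)
  linarith

lemma tri_lip (h : ℕ) (j k : ℤ) : |tri h j - tri h (j + k)| ≤ |(k : ℝ)| := by
  unfold tri
  have : |max 0 ((h : ℤ) + 1 - |j|) - max 0 ((h : ℤ) + 1 - |j + k|)| ≤ |k| := by
    grind
  exact_mod_cast this

lemma B_diff_le (h k : ℕ) : 2 * (B h 0 - B h k) ≤ (2 * h + 1 + k) * (k : ℝ) ^ 2 := by
  rw [B_diff, tsum_eq_sum (s := Finset.Icc (-(h : ℤ) - k) h)]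
  · refine (Finset.sum_le_card_nsmul _ _ ((k : ℝ) ^ 2) (fun j _ => ?_)).trans ?_
    · have := tri_lip h j k
      rw [← sq_abs]
      have h2 : |((k : ℤ) : ℝ)| = (k : ℝ) := by simp
      rw [h2] at this
      gcongr
    · rw [nsmul_eq_mul]
      apply le_of_eq
      congr 1
      rw [Int.card_Icc]
      have : ((((h : ℤ) + 1 - (-(h : ℤ) - k)).toNat : ℤ) : ℝ) = 2 * h + 1 + k := by
        rw [Int.toNat_of_nonneg (by omega)]; push_cast; ring
      exact_mod_cast this
  · intro j hj
    rw [tri_zero, tri_zero]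
    · simp
    all_goals
      rw [Finset.mem_Icc] at *
      omega

lemma B_zero_ge (m : ℕ) : ((2 * m + 1 : ℕ) : ℝ) ^ 3 / 4 ≤ B (2 * m) 0 := by
  unfold B
  have hs := summable_tri (2 * m) (fun j => tri (2 * m) (j + 0))
  refine le_trans ?_ (hs.sum_le_tsum (Finset.Icc (-(m : ℤ)) m)
    (fun j _ => mul_nonneg (tri_nonneg _ _) (tri_nonneg _ _)))
  have : ∀ j ∈ Finset.Icc (-(m : ℤ)) m, ((m : ℝ) + 1) ^ 2 ≤
      tri (2 * m) j * tri (2 * m) (j + 0) := by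
    intro j hj
    rw [Finset.mem_Icc] at hj
    rw [add_zero, ← sq]
    have : (m : ℝ) + 1 ≤ tri (2 * m) j := by
      unfold tri
      have : (m : ℤ) + 1 ≤ max 0 (((2 * m : ℕ) : ℤ) + 1 - |j|) := by grind
      exact_mod_cast this
    gcongr
  refine le_trans ?_ (Finset.card_nsmul_le_sum _ _ _ this)
  have hc : ((Finset.Icc (-(m : ℤ)) m).card : ℝ) = 2 * m + 1 := by
    rw [Int.card_Icc]
    have : ((((m : ℤ) + 1 - (-(m : ℤ))).toNat : ℤ) : ℝ) = 2 * m + 1 := by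
      rw [Int.toNat_of_nonneg (by omega)]; push_cast; ring
    exact_mod_cast this
  rw [nsmul_eq_mul, hc]
  push_cast
  have : (0 : ℝ) ≤ m := by positivity
  nlinarith [mul_nonneg this this]

lemma kernel_nonneg (h : ℕ) (t : ℝ) :
    0 ≤ 2 * (∑ k ∈ Finset.range (2 * h + 1), B h k * Real.cos (k * t)) - B h 0 := by
  have hev : (fun k : ℤ => B h k * Real.cos (k * t)).Even := by
    intro k
    simp [B_neg]
  have e1 := Finset.sum_Icc_of_even_eq_range hev (2 * h)
  have e2 : ∑ m ∈ Finset.Icc (-((2 * h : ℕ) : ℤ)) ((2 * h : ℕ) : ℤ), B h m * Real.cos (m * t)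
      = (∑ j ∈ Finset.Icc (-(h : ℤ)) h, tri h j * Real.cos (j * t)) ^ 2
        + (∑ j ∈ Finset.Icc (-(h : ℤ)) h, tri h j * Real.sin (j * t)) ^ 2 := by
    have hB : ∀ m, B h m = ∑ j ∈ Finset.Icc (-(h : ℤ)) h, tri h j * tri h (j + m) :=
      fun m => B_eq_sum h m _ (fun j hj _ => hj)
    simp_rw [hB, Finset.sum_mul]
    rw [Finset.sum_comm, sq, sq, Finset.sum_mul_sum, Finset.sum_mul_sum, ← Finset.sum_add_distrib]
    refine Finset.sum_congr rfl (fun j hj => ?_)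
    rw [← Finset.sum_add_distrib]
    rw [Finset.mem_Icc] at hj
    trans ∑' m : ℤ, tri h j * tri h (j + m) * Real.cos (m * t)
    · symm
      refine tsum_eq_sum (fun m hm => ?_)
      rw [tri_zero h (j + m)]
      · simp
      · rw [Finset.mem_Icc] at *
        push_cast at hm
        omega
    rw [← (Equiv.addRight (-j)).tsum_eq, tsum_eq_sum (s := Finset.Icc (-(h : ℤ)) h)]
    · refine Finset.sum_congr rfl (fun l hl => ?_)
      simp only [Equiv.coe_addRight, add_neg_cancel_comm_assoc]
      push_cast
      rw [show ((l : ℝ) + -j) * t = l * t - j * t by ring, Real.cos_sub]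
      ring
    · intro l hl
      simp only [Equiv.coe_addRight, add_neg_cancel_comm_assoc]
      rw [tri_zero h l hl]
      simp
  rw [e2] at e1
  simp only [nsmul_eq_mul, Int.cast_zero, zero_mul, Real.cos_zero, mul_one, Int.cast_natCast] at e1
  push_cast at e1
  rw [← e1]
  positivity

end KPM

namespace KPM

open Polynomial.Chebyshev

lemma Tbar_zero (x : ℝ) : Tbar 0 x = 1 / Real.sqrt Real.pi := by
  simp [Tbar]

lemma Tbar_of_ne {k : ℕ} (hk : k ≠ 0) (x : ℝ) :
    Tbar k x = Real.sqrt (2 / Real.pi) * ((Polynomial.Chebyshev.T ℝ (k : ℤ)).eval x) := by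
  simp [Tbar, hk]

lemma Tbar_cont (k : ℕ) : Continuous (Tbar k) := by
  unfold Tbar
  split_ifs <;> fun_prop

lemma sqrt_two_pi_sq : Real.sqrt (2 / Real.pi) * Real.sqrt (2 / Real.pi) = 2 / Real.pi :=
  Real.mul_self_sqrt (by positivity)

lemma Tbar_abs_le {k : ℕ} (hk : k ≠ 0) {x : ℝ} (hx : x ∈ Set.Icc (-1 : ℝ) 1) :
    |Tbar k x| ≤ Real.sqrt (2 / Real.pi) := by
  rw [Tbar_of_ne hk, abs_mul, abs_of_nonneg (Real.sqrt_nonneg _)]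
  have := abs_eval_T_real_le_one (k : ℤ) (x := x) (abs_le.mpr hx)
  exact mul_le_of_le_one_right (Real.sqrt_nonneg _) this

lemma orth (j k : ℕ) : ∫ x, Tbar j x * Tbar k x ∂measureT = if j = k then 1 else 0 := by
  have hpi := Real.pi_pos
  have hform : ∀ j : ℕ, ∃ c : ℝ, (c * c * (if j = 0 then Real.pi else Real.pi / 2) = 1) ∧
      ∀ x, Tbar j x = c * (T ℝ (j : ℤ)).eval x := by
    intro j
    by_cases hj : j = 0
    · subst hj
      refine ⟨1 / Real.sqrt Real.pi, ?_, fun x => by simp [Tbar]⟩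
      have := Real.mul_self_sqrt hpi.le
      have h2 : Real.sqrt Real.pi ≠ 0 := (Real.sqrt_pos.mpr hpi).ne'
      simp only [if_true]
      field_simp
      nlinarith
    · refine ⟨Real.sqrt (2 / Real.pi), ?_, fun x => Tbar_of_ne hj x⟩
      rw [sqrt_two_pi_sq, if_neg hj]
      field_simp
  obtain ⟨c, hc, hcx⟩ := hform j
  obtain ⟨d, hd, hdx⟩ := hform k
  have e : (fun x => Tbar j x * Tbar k x) =
      fun x => (c * d) * ((T ℝ (j : ℤ)).eval x * (T ℝ (k : ℤ)).eval x) := by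
    funext x; rw [hcx, hdx]; ring
  rw [e, integral_const_mul]
  by_cases hjk : j = k
  · subst hjk
    rw [if_pos rfl]
    by_cases hj : j = 0
    · subst hj
      have := integral_eval_T_real_mul_self_measureT_zero
      simp only [Nat.cast_zero]
      rw [this]
      have hh : c * (1:ℝ) = d * 1 := by
        have h1 := hcx 0; have h2 := hdx 0
        simp at h1 h2
        linarith
      have : c = d := by linarith
      subst this
      simpa using hc
    · rw [integral_T_real_mul_self_measureT_of_ne_zero hj]
      rw [if_neg hj] at hc
      have h1 := hcx 1; have h2 := hdx 1
      rw [h1] at h2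
      have : c = d := by simpa using h2
      subst this
      exact hc
  · rw [if_neg hjk, integral_eval_T_real_mul_eval_T_real_measureT_of_ne hjk, mul_zero]

lemma integ {g : ℝ → ℝ} (hg : Continuous g) : Integrable g measureT :=
  integrable_measureT hg.continuousOn

lemma cont_sum (N : ℕ) (c : ℕ → ℝ) :
    Continuous (fun x => ∑ k ∈ Finset.range (N + 1), c k * Tbar k x) :=
  continuous_finsetSum _ (fun k _ => continuous_const.mul (Tbar_cont k))

lemma repro (N j : ℕ) (hj : j ≤ N) (c : ℕ → ℝ) :
    ∫ x, Tbar j x * ∑ k ∈ Finset.range (N + 1), c k * Tbar k x ∂measureT = c j := by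
  have e : ∀ x, Tbar j x * ∑ k ∈ Finset.range (N + 1), c k * Tbar k x
      = ∑ k ∈ Finset.range (N + 1), c k * (Tbar j x * Tbar k x) := by
    intro x; rw [Finset.mul_sum]; exact Finset.sum_congr rfl (fun k _ => by ring)
  simp_rw [e]
  rw [integral_finsetSum _ (fun k _ => integ (g := fun x => c k * (Tbar j x * Tbar k x))
    (continuous_const.mul ((Tbar_cont j).mul (Tbar_cont k))))]
  simp_rw [integral_const_mul, orth]
  simp [Finset.sum_ite_eq, Nat.lt_succ_of_le hj]

lemma repro_zero (N : ℕ) (c : ℕ → ℝ) :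
    ∫ x, ∑ k ∈ Finset.range (N + 1), c k * Tbar k x ∂measureT = Real.sqrt Real.pi * c 0 := by
  rw [← repro N 0 (Nat.zero_le _) c, ← integral_const_mul]
  congr 1
  funext x
  have : Real.sqrt Real.pi ≠ 0 := (Real.sqrt_pos.mpr Real.pi_pos).ne'
  rw [Tbar_zero]
  field_simp

noncomputable def rho (N k : ℕ) : ℝ := bhat N k / bhat N 0

noncomputable def ker (N : ℕ) (y x : ℝ) : ℝ :=
  ∑ k ∈ Finset.range (N + 1), (rho N k * Tbar k y) * Tbar k x

lemma B_zero_pos (m : ℕ) : 0 < B (2 * m) 0 :=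
  lt_of_lt_of_le (by positivity) (B_zero_ge m)

lemma rho_eq (m k : ℕ) (hk : k ≤ 2 * (2 * m)) :
    rho (2 * (2 * m)) k = B (2 * m) k / B (2 * m) 0 := by
  unfold rho
  rw [bhat_eq _ _ hk, bhat_eq _ _ (Nat.zero_le _)]; rfl

lemma ker_nonneg (m : ℕ) {x y : ℝ} (hx : x ∈ Set.Icc (-1 : ℝ) 1) (hy : y ∈ Set.Icc (-1 : ℝ) 1) :
    0 ≤ ker (2 * (2 * m)) y x := by
  have hpi := Real.pi_pos
  have hB := B_zero_pos m
  set θ := Real.arccos x with hθ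
  set φ := Real.arccos y with hφ
  have hxc : x = Real.cos θ := (Real.cos_arccos hx.1 hx.2).symm
  have hyc : y = Real.cos φ := (Real.cos_arccos hy.1 hy.2).symm
  have k1 := kernel_nonneg (2 * m) (θ - φ)
  have k2 := kernel_nonneg (2 * m) (θ + φ)
  have e : ker (2 * (2 * m)) y x = 1 / (2 * Real.pi * B (2 * m) 0) *
      ((2 * (∑ k ∈ Finset.range (2 * (2 * m) + 1), B (2 * m) k * Real.cos (k * (θ - φ)))
          - B (2 * m) 0) +
       (2 * (∑ k ∈ Finset.range (2 * (2 * m) + 1), B (2 * m) k * Real.cos (k * (θ + φ)))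
          - B (2 * m) 0)) := by
    have s1 : ∀ k ∈ Finset.range (2 * (2 * m) + 1), (rho (2 * (2 * m)) k * Tbar k y) * Tbar k x
        = 1 / (Real.pi * B (2 * m) 0) * (B (2 * m) k * Real.cos (k * (θ - φ)))
          + 1 / (Real.pi * B (2 * m) 0) * (B (2 * m) k * Real.cos (k * (θ + φ)))
          - (if k = 0 then 1 / Real.pi else 0) := by
      intro k hk
      have hk' : k ≤ 2 * (2 * m) := by simpa [Nat.lt_succ_iff] using hk
      rw [rho_eq m k hk']
      by_cases h0 : k = 0
      · subst h0
        have := Real.mul_self_sqrt hpi.le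
        have h2 : Real.sqrt Real.pi ≠ 0 := (Real.sqrt_pos.mpr hpi).ne'
        simp only [Tbar_zero, Nat.cast_zero, zero_mul, Real.cos_zero, if_true]
        field_simp
        rw [Real.sq_sqrt hpi.le]
        norm_num
      · rw [Tbar_of_ne h0, Tbar_of_ne h0, hxc, hyc, T_real_cos, T_real_cos, if_neg h0,
          mul_sub, mul_add, Real.cos_sub, Real.cos_add]
        have := sqrt_two_pi_sq
        calc _ = (Real.sqrt (2 / Real.pi) * Real.sqrt (2 / Real.pi)) * (B (2 * m) k / B (2 * m) 0)
              * (Real.cos (k * θ) * Real.cos (k * φ)) := by push_cast; ring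
          _ = _ := by rw [this]; field_simp; ring
    unfold ker
    rw [Finset.sum_congr rfl s1, Finset.sum_sub_distrib, Finset.sum_add_distrib,
      ← Finset.mul_sum, ← Finset.mul_sum]
    simp only [Finset.sum_ite_eq', Finset.mem_range, Nat.zero_lt_succ, if_true]
    generalize (∑ k ∈ Finset.range (2 * (2 * m) + 1), B (2 * m) k * Real.cos (k * (θ - φ))) = S1
    generalize (∑ k ∈ Finset.range (2 * (2 * m) + 1), B (2 * m) k * Real.cos (k * (θ + φ))) = S2
    field_simp
    ring
  rw [e]
  positivity

lemma ker_cont (N : ℕ) (y : ℝ) : Continuous (ker N y) := cont_sum N _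

lemma rho_zero (m : ℕ) : rho (2 * (2 * m)) 0 = 1 := by
  rw [rho_eq m 0 (Nat.zero_le _)]
  exact div_self (B_zero_pos m).ne'

lemma ker_int (m : ℕ) (y : ℝ) : ∫ x, ker (2 * (2 * m)) y x ∂measureT = 1 := by
  unfold ker
  rw [repro_zero, rho_zero, Tbar_zero]
  have : Real.sqrt Real.pi ≠ 0 := (Real.sqrt_pos.mpr Real.pi_pos).ne'
  field_simp

lemma ker_T (N j : ℕ) (hj : j ≤ N) (hj0 : j ≠ 0) (y : ℝ) :
    ∫ x, (T ℝ (j : ℤ)).eval x * ker N y x ∂measureT = rho N j * (T ℝ (j : ℤ)).eval y := by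
  have h := repro N j hj (fun k => rho N k * Tbar k y)
  have hs : Real.sqrt (2 / Real.pi) ≠ 0 := (Real.sqrt_pos.mpr (by positivity)).ne'
  simp only [Tbar_of_ne hj0] at h
  have e : ∀ x, Real.sqrt (2 / Real.pi) * (T ℝ (j : ℤ)).eval x *
      ∑ k ∈ Finset.range (N + 1), rho N k * Tbar k y * Tbar k x =
      Real.sqrt (2 / Real.pi) * ((T ℝ (j : ℤ)).eval x * ker N y x) := by
    intro x; unfold ker; ring
  simp_rw [e] at h
  rw [integral_const_mul] at h
  apply mul_left_cancel₀ hs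
  rw [h]; ring

lemma ker_sq (m : ℕ) (hm : 0 < m) {y : ℝ} (hy : y ∈ Set.Icc (-1 : ℝ) 1) :
    ∫ x, (x - y) ^ 2 * ker (2 * (2 * m)) y x ∂measureT ≤ 20 / ((2 * m + 1 : ℕ) : ℝ) ^ 2 := by
  have t1 := ker_T (2 * (2 * m)) 1 (by omega) (by norm_num) y
  have t2 := ker_T (2 * (2 * m)) 2 (by omega) (by norm_num) y
  have t0 := ker_int m y
  have kc := ker_cont (2 * (2 * m)) y
  have e : ∀ x, (x - y) ^ 2 * ker (2 * (2 * m)) y x =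
      (1 / 2 * ((T ℝ ((2 : ℕ) : ℤ)).eval x * ker (2 * (2 * m)) y x)
        + (-(2 * y)) * ((T ℝ ((1 : ℕ) : ℤ)).eval x * ker (2 * (2 * m)) y x))
        + (y ^ 2 + 1 / 2) * ker (2 * (2 * m)) y x := by
    intro x
    simp [T_two]
    ring
  simp_rw [e]
  have c1 : Continuous fun x => (T ℝ ((1 : ℕ) : ℤ)).eval x * ker (2 * (2 * m)) y x := by fun_prop
  have c2 : Continuous fun x => (T ℝ ((2 : ℕ) : ℤ)).eval x * ker (2 * (2 * m)) y x := by fun_prop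
  rw [integral_add (integ (by fun_prop)) (integ (by fun_prop)),
    integral_add (integ (by fun_prop)) (integ (by fun_prop)), integral_const_mul,
    integral_const_mul, integral_const_mul, t0, t1, t2]
  rw [rho_eq m 1 (by omega), rho_eq m 2 (by omega)]
  have b0 := B_zero_ge m
  have b1 := B_diff_le (2 * m) 1
  have b2 := B_diff_le (2 * m) 2
  have l1 := B_le (2 * m) 1
  have l2 := B_le (2 * m) 2
  have hB := B_zero_pos m
  simp only [Nat.cast_ofNat, Nat.cast_one, T_two, T_one, Polynomial.eval_sub, Polynomial.eval_mul,
    Polynomial.eval_pow, Polynomial.eval_X, Polynomial.eval_one, Polynomial.eval_ofNat] at *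
  push_cast at *
  set b := B (2 * m) 0
  set u := B (2 * m) 1
  set v := B (2 * m) 2
  set M : ℝ := 2 * m + 1 with hM
  have hMp : 0 < M := by positivity
  have hm1 : (1 : ℝ) ≤ m := by exact_mod_cast hm
  have hy2 : y ^ 2 ≤ 1 := by nlinarith [hy.1, hy.2]
  have key : (1 / 2 * (v / b * (2 * y ^ 2 - 1)) + -(2 * y) * (u / b * y) + (y ^ 2 + 1 / 2) * 1) * b
      ≤ 5 * M := by
    have : (1 / 2 * (v / b * (2 * y ^ 2 - 1)) + -(2 * y) * (u / b * y) + (y ^ 2 + 1 / 2) * 1) * b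
      = (b - v) * (1 / 2 - y ^ 2) + 2 * y ^ 2 * (b - u) := by
      field_simp; ring
    rw [this]
    nlinarith [mul_nonneg (sub_nonneg.mpr l2) (sq_nonneg y),
      mul_nonneg (sub_nonneg.mpr l1) (sub_nonneg.mpr hy2)]
  rw [le_div_iff₀ (by positivity)]
  rw [← le_div_iff₀ hB] at key
  calc _ ≤ (5 * M / b) * M ^ 2 := by gcongr
    _ ≤ 20 := by
      rw [div_mul_eq_mul_div, div_le_iff₀ hB]
      nlinarith

end KPM

namespace KPM

open Polynomial.Chebyshev

lemma int_w (g : ℝ → ℝ) : ∫ x in (-1 : ℝ)..1, g x * wCheb x = ∫ x, g x ∂measureT := by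
  rw [integral_measureT]
  simp only [wCheb, one_div, Real.sqrt_inv]

/-- error part of the density -/
noncomputable def err (N n : ℕ) (lam : Fin n → ℝ) (tauT : ℕ → ℝ) (x : ℝ) : ℝ :=
  ∑ k ∈ Finset.range (N + 1), (rho N k * (tauT k - chebMoment n lam k)) * Tbar k x
    + Real.sqrt 2 / (N * Real.sqrt Real.pi)

lemma err_cont (N n : ℕ) (lam : Fin n → ℝ) (tauT : ℕ → ℝ) : Continuous (err N n lam tauT) :=
  (cont_sum N _).add continuous_const

lemma chebMoment_zero (n : ℕ) (hn : 0 < n) (lam : Fin n → ℝ) :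
    chebMoment n lam 0 = 1 / Real.sqrt Real.pi := by
  have : (n : ℝ) ≠ 0 := by exact_mod_cast hn.ne'
  simp [chebMoment, Tbar_zero]
  field_simp

lemma int_one : ∫ _x : ℝ, (1 : ℝ) ∂measureT = Real.pi := by
  simpa using integral_eval_T_real_measureT_zero

lemma sqrt_c (N : ℕ) (hN : 0 < N) :
    Real.pi * (Real.sqrt 2 / (N * Real.sqrt Real.pi)) = Real.sqrt (2 * Real.pi) / N := by
  have h2 : Real.sqrt Real.pi ≠ 0 := (Real.sqrt_pos.mpr Real.pi_pos).ne'
  have : (N : ℝ) ≠ 0 := by exact_mod_cast hN.ne'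
  rw [Real.sqrt_mul (by norm_num)]
  field_simp
  rw [Real.sq_sqrt Real.pi_pos.le]

lemma err_int (N n : ℕ) (hN : 0 < N) (hn : 0 < n) (lam : Fin n → ℝ) (tauT : ℕ → ℝ)
    (htau0 : tauT 0 = 1 / Real.sqrt Real.pi) :
    ∫ x, err N n lam tauT x ∂measureT = Real.sqrt (2 * Real.pi) / N := by
  unfold err
  rw [integral_add (integ (cont_sum N _)) (integ continuous_const), repro_zero, htau0,
    chebMoment_zero n hn, ← sqrt_c N hN]
  have : ∫ _x : ℝ, Real.sqrt 2 / (N * Real.sqrt Real.pi) ∂measureT =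
      (Real.sqrt 2 / (N * Real.sqrt Real.pi)) * ∫ _x : ℝ, (1 : ℝ) ∂measureT := by
    rw [← integral_const_mul]; simp only [mul_one]
  rw [this, int_one]
  ring

lemma err_nonneg (m n : ℕ) (hm : 0 < m) (hn : 0 < n) (lam : Fin n → ℝ) (tauT : ℕ → ℝ)
    (htau0 : tauT 0 = 1 / Real.sqrt Real.pi)
    (htau : ∀ k, 1 ≤ k → k ≤ 2 * (2 * m) →
      |tauT k - chebMoment n lam k| ≤ 1 / ((2 * (2 * m) : ℕ) : ℝ) ^ 2)
    {x : ℝ} (hx : x ∈ Set.Icc (-1 : ℝ) 1) : 0 ≤ err (2 * (2 * m)) n lam tauT x := by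
  unfold err
  set N := 2 * (2 * m) with hN
  have hNp : (0 : ℝ) < N := by
    have : 0 < N := by omega
    exact_mod_cast this
  have hB := B_zero_pos m
  have hb : |∑ k ∈ Finset.range (N + 1), (rho N k * (tauT k - chebMoment n lam k)) * Tbar k x|
      ≤ Real.sqrt 2 / (N * Real.sqrt Real.pi) := by
    rw [Finset.sum_range_succ', htau0, chebMoment_zero n hn]
    simp only [sub_self, mul_zero, zero_mul, add_zero]
    refine (Finset.abs_sum_le_sum_abs _ _).trans ?_
    refine (Finset.sum_le_card_nsmul _ _ (1 / (N : ℝ) ^ 2 * Real.sqrt (2 / Real.pi))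
      (fun k hk => ?_)).trans ?_
    · have hk' : k + 1 ≤ N := by simpa using hk
      rw [abs_mul, abs_mul]
      have h1 : |rho N (k + 1)| ≤ 1 := by
        rw [rho_eq m _ hk', abs_of_nonneg (div_nonneg (B_nonneg _ _) hB.le)]
        exact (div_le_one hB).mpr (B_le _ _)
      have h2 := htau (k + 1) (by omega) hk'
      have h3 := Tbar_abs_le (k := k + 1) (by omega) hx
      calc _ ≤ 1 * (1 / (N : ℝ) ^ 2) * Real.sqrt (2 / Real.pi) := by gcongr
        _ = _ := by ring
    · rw [nsmul_eq_mul, Finset.card_range, Real.sqrt_div (by norm_num)]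
      apply le_of_eq
      have h2 : Real.sqrt Real.pi ≠ 0 := (Real.sqrt_pos.mpr Real.pi_pos).ne'
      field_simp
  have := (abs_le.mp hb).1
  linarith

lemma density_eq (N n : ℕ) (lam : Fin n → ℝ) (tauT : ℕ → ℝ) (x : ℝ) :
    kpmDensityApprox N tauT x =
      (((1 / (n : ℝ)) * ∑ i, ker N (lam i) x + err N n lam tauT x) /
        (1 + Real.sqrt (2 * Real.pi) / N)) * wCheb x := by
  have e : ∑ k ∈ Finset.range (N + 1), (bhat N k / bhat N 0) * tauT k * Tbar k x =
      (1 / (n : ℝ)) * ∑ i, ker N (lam i) x +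
      ∑ k ∈ Finset.range (N + 1), (rho N k * (tauT k - chebMoment n lam k)) * Tbar k x := by
    unfold ker
    rw [Finset.sum_comm, Finset.mul_sum, ← Finset.sum_add_distrib]
    refine Finset.sum_congr rfl (fun k _ => ?_)
    have : ∑ i, rho N k * Tbar k (lam i) * Tbar k x = rho N k * (∑ i, Tbar k (lam i)) * Tbar k x := by
      rw [Finset.mul_sum, Finset.sum_mul]
    rw [this]
    simp only [rho, chebMoment]
    ring
  unfold kpmDensityApprox sTilde err
  rw [e]
  ring

lemma ae_Icc : ∀ᵐ x ∂measureT, x ∈ Set.Icc (-1 : ℝ) 1 := by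
  unfold measureT
  filter_upwards [ae_restrict_mem measurableSet_Ioc] with x hx
  exact ⟨hx.1.le, hx.2⟩

lemma single_bound (m : ℕ) (hm : 0 < m) {y : ℝ} (hy : y ∈ Set.Icc (-1 : ℝ) 1)
    (e : ℝ → ℝ) (he : Continuous e) (he0 : ∀ x ∈ Set.Icc (-1 : ℝ) 1, 0 ≤ e x)
    (c : ℝ) (hc : ∫ x, e x ∂measureT = c) (f : ℝ → ℝ) 
    (hf : ∀ x ∈ Set.Icc (-1 : ℝ) 1, ∀ y ∈ Set.Icc (-1 : ℝ) 1, |f x - f y| ≤ |x - y|)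
    (hfc : ContinuousOn f (Set.Icc (-1 : ℝ) 1)) :
    |f y * (1 + c) - ∫ x, f x * (ker (2 * (2 * m)) y x + e x) ∂measureT|
      ≤ 9 / 2 / ((2 * m + 1 : ℕ) : ℝ) + 2 * c := by
  have kc := ker_cont (2 * (2 * m)) y
  have h1 : f y * (1 + c) = ∫ x, f y * (ker (2 * (2 * m)) y x + e x) ∂measureT := by
    rw [integral_const_mul, integral_add (integ kc) (integ he), ker_int, hc]
  have i2 : Integrable (fun x => f x * (ker (2 * (2 * m)) y x + e x)) measureT :=
    integrable_measureT (hfc.mul (kc.add he).continuousOn)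
  rw [h1, ← integral_sub (integ (by fun_prop)) i2]
  set M : ℝ := ((2 * m + 1 : ℕ) : ℝ) with hM
  have hMp : 0 < M := by rw [hM]; positivity
  have hbound : ∀ᵐ x ∂measureT, ‖f y * (ker (2 * (2 * m)) y x + e x) -
      f x * (ker (2 * (2 * m)) y x + e x)‖ ≤
      (M / 8 * ((x - y) ^ 2 * ker (2 * (2 * m)) y x) + 2 / M * ker (2 * (2 * m)) y x)
        + 2 * e x := by
    filter_upwards [ae_Icc] with x hx
    have hk := ker_nonneg m hx hy
    have hex := he0 x hx
    have hl := hf y hy x hx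
    rw [Real.norm_eq_abs, ← sub_mul, abs_mul, abs_of_nonneg (add_nonneg hk hex), mul_add]
    have g1 : |f y - f x| ≤ M / 8 * (x - y) ^ 2 + 2 / M := by
      refine hl.trans ?_
      rw [abs_sub_comm, ← sq_abs (x - y)]
      have : M / 8 * |x - y| ^ 2 + 2 / M - |x - y| = (M * |x - y| - 4) ^ 2 / (8 * M) := by
        field_simp; ring
      have h0 : 0 ≤ (M * |x - y| - 4) ^ 2 / (8 * M) := by positivity
      linarith
    have g2 : |f y - f x| ≤ 2 := by
      refine hl.trans (abs_le.mpr ⟨?_, ?_⟩) <;> linarith [hx.1, hx.2, hy.1, hy.2]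
    have := mul_le_mul_of_nonneg_right g1 hk
    have := mul_le_mul_of_nonneg_right g2 hex
    linarith
  have hi := norm_integral_le_of_norm_le (integ (by fun_prop)) hbound
  rw [Real.norm_eq_abs] at hi
  refine hi.trans ?_
  rw [integral_add (integ (by fun_prop)) (integ (by fun_prop)),
    integral_add (integ (by fun_prop)) (integ (by fun_prop)), integral_const_mul,
    integral_const_mul, integral_const_mul, ker_int, hc]
  have := ker_sq m hm hy
  rw [← hM] at this
  have h3 : M / 8 * ∫ x, (x - y) ^ 2 * ker (2 * (2 * m)) y x ∂measureT ≤ M / 8 * (20 / M ^ 2) := by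
    gcongr
  have h4 : M / 8 * (20 / M ^ 2) + 2 / M * 1 = 9 / 2 / M := by field_simp; norm_num
  linarith

end KPM

/-- **Guarantee for the full (robust) Jackson damped kernel polynomial method.**
If `N ≥ 18/ε` is a positive multiple of `4` and the approximate moments `τ̃_k` satisfy
`τ̃_0 = 1/√π` and `|τ̃_k - τ_k| ≤ 1/N²` for `1 ≤ k ≤ N`, then `q` is a probability
density on `[-1,1]` whose Wasserstein-1 distance to the spectral density
`s = (1/n)·Σ_i δ(x - λ_i)` is at most `2ε`, in the dual (Kantorovich–Rubinstein)
formulation. -/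
theorem robust_kpm_guarantee (n : ℕ) (hn : 0 < n)
    (lam : Fin n → ℝ) (hlam : ∀ i, lam i ∈ Set.Icc (-1 : ℝ) 1)
    (ε : ℝ) (hε : ε ∈ Set.Ioo (0 : ℝ) 1)
    (N : ℕ) (hNpos : 0 < N) (hN4 : 4 ∣ N) (hNε : 18 / ε ≤ (N : ℝ))
    (tauT : ℕ → ℝ) (htau0 : tauT 0 = 1 / Real.sqrt Real.pi)
    (htau : ∀ k, 1 ≤ k → k ≤ N → |tauT k - chebMoment n lam k| ≤ 1 / (N : ℝ) ^ 2) :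
    (∀ x ∈ Set.Ioo (-1 : ℝ) 1, 0 ≤ kpmDensityApprox N tauT x) ∧
    (∫ x in (-1 : ℝ)..1, kpmDensityApprox N tauT x) = 1 ∧
    ∀ f : ℝ → ℝ,
      (∀ x ∈ Set.Icc (-1 : ℝ) 1, ∀ y ∈ Set.Icc (-1 : ℝ) 1, |f x - f y| ≤ |x - y|) →
      |(1 / (n : ℝ)) * ∑ i, f (lam i) -
          ∫ x in (-1 : ℝ)..1, f x * kpmDensityApprox N tauT x| ≤ 2 * ε := by
  classical
  obtain ⟨m, rfl⟩ : ∃ m, N = 2 * (2 * m) := by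
    obtain ⟨m, rfl⟩ := hN4
    exact ⟨m, by ring⟩
  have hm : 0 < m := by omega
  set N := 2 * (2 * m) with hN
  have hNp : (0 : ℝ) < N := by exact_mod_cast hNpos
  have hnp : (0 : ℝ) < n := by exact_mod_cast hn
  have hc0 : 0 ≤ Real.sqrt (2 * Real.pi) / N := by positivity
  have herr0 : ∀ x ∈ Set.Icc (-1 : ℝ) 1, 0 ≤ KPM.err N n lam tauT x :=
    fun x hx => KPM.err_nonneg m n hm hn lam tauT htau0 htau hx
  have herrI := KPM.err_int N n hNpos hn lam tauT htau0
  have herrC := KPM.err_cont N n lam tauT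
  have hkC := fun y => KPM.ker_cont N y
  set c := Real.sqrt (2 * Real.pi) / N with hc
  -- main identity for integrals against `q`
  have hint : ∀ f : ℝ → ℝ, ContinuousOn f (Set.Icc (-1 : ℝ) 1) →
      ∫ x in (-1 : ℝ)..1, f x * kpmDensityApprox N tauT x =
        (1 / (n : ℝ)) * ∑ i, (∫ x, f x * (KPM.ker N (lam i) x + KPM.err N n lam tauT x)
          ∂Polynomial.Chebyshev.measureT) / (1 + c) := by
    intro f hfc
    have e : ∀ x, f x * kpmDensityApprox N tauT x =
        ((1 / (n : ℝ) / (1 + c)) * ∑ i, f x * (KPM.ker N (lam i) x + KPM.err N n lam tauT x))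
          * wCheb x := by
      intro x
      rw [KPM.density_eq N n lam tauT x, ← Finset.mul_sum, Finset.sum_add_distrib,
        Finset.sum_const, Finset.card_univ, Fintype.card_fin, nsmul_eq_mul, ← hc]
      field_simp
    simp_rw [e]
    rw [KPM.int_w (fun x => (1 / (n : ℝ) / (1 + c)) *
      ∑ i, f x * (KPM.ker N (lam i) x + KPM.err N n lam tauT x)), integral_const_mul,
      integral_finsetSum _ (fun i _ => Polynomial.Chebyshev.integrable_measureT
        (f := fun x => f x * (KPM.ker N (lam i) x + KPM.err N n lam tauT x))
        (hfc.mul ((hkC (lam i)).add herrC).continuousOn)), ← Finset.sum_div]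
    ring
  refine ⟨?_, ?_, ?_⟩
  · intro x hx
    have hx' : x ∈ Set.Icc (-1 : ℝ) 1 := ⟨hx.1.le, hx.2.le⟩
    rw [KPM.density_eq N n lam tauT x]
    have h1 : 0 ≤ ∑ i, KPM.ker N (lam i) x :=
      Finset.sum_nonneg (fun i _ => KPM.ker_nonneg m hx' (hlam i))
    have h2 := herr0 x hx'
    have h3 : 0 ≤ wCheb x := by unfold wCheb; positivity
    positivity
  · have h := hint (fun _ => 1) continuousOn_const
    simp only [one_mul] at h
    rw [h]
    have : ∀ i, ∫ x, (KPM.ker N (lam i) x + KPM.err N n lam tauT x)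
          ∂Polynomial.Chebyshev.measureT = 1 + c := fun i => by
      rw [integral_add (KPM.integ (hkC _)) (KPM.integ herrC), KPM.ker_int, herrI]
    simp_rw [this]
    rw [Finset.sum_const, Finset.card_univ, Fintype.card_fin, nsmul_eq_mul]
    field_simp
  · intro f hf
    have hfc : ContinuousOn f (Set.Icc (-1 : ℝ) 1) := by
      have : LipschitzOnWith 1 f (Set.Icc (-1 : ℝ) 1) := by
        refine LipschitzOnWith.of_dist_le_mul (fun x hx y hy => ?_)
        simpa [Real.dist_eq] using hf x hx y hy
      exact this.continuousOn
    rw [hint f hfc, ← mul_sub, ← Finset.sum_sub_distrib, abs_mul, abs_of_nonneg (by positivity)]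
    set R : ℝ := 9 / 2 / ((2 * m + 1 : ℕ) : ℝ) + 2 * c with hR
    have hR0 : 0 ≤ R := by positivity
    have hi : ∀ i, |f (lam i) - (∫ x, f x * (KPM.ker N (lam i) x + KPM.err N n lam tauT x)
          ∂Polynomial.Chebyshev.measureT) / (1 + c)| ≤ R := by
      intro i
      have h := KPM.single_bound m hm (hlam i) _ herrC herr0 c herrI f hf hfc
      have hD : 1 ≤ 1 + c := by linarith
      have e : f (lam i) - (∫ x, f x * (KPM.ker N (lam i) x + KPM.err N n lam tauT x)
          ∂Polynomial.Chebyshev.measureT) / (1 + c) = (f (lam i) * (1 + c) -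
          (∫ x, f x * (KPM.ker N (lam i) x + KPM.err N n lam tauT x)
          ∂Polynomial.Chebyshev.measureT)) / (1 + c) := by
        field_simp
      rw [e, abs_div, abs_of_pos (by linarith : 0 < 1 + c)]
      exact (div_le_self (abs_nonneg _) hD).trans h
    have hs := (Finset.abs_sum_le_sum_abs (fun i => f (lam i) -
      (∫ x, f x * (KPM.ker N (lam i) x + KPM.err N n lam tauT x)
          ∂Polynomial.Chebyshev.measureT) / (1 + c)) Finset.univ).trans
      (Finset.sum_le_card_nsmul _ _ R (fun i _ => hi i))
    rw [Finset.card_univ, Fintype.card_fin, nsmul_eq_mul] at hs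
    have hRb : R ≤ 18 / N := by
      have h1 : Real.sqrt (2 * Real.pi) ≤ 3 := by
        rw [Real.sqrt_le_left (by norm_num)]
        linarith [Real.pi_lt_four]
      have h2 : c ≤ 3 / N := by rw [hc]; gcongr
      have h3 : 9 / 2 / ((2 * m + 1 : ℕ) : ℝ) ≤ 9 / N := by
        have hNN : (N : ℝ) = 4 * m := by rw [hN]; push_cast; ring
        have hmp : (0 : ℝ) < m := by exact_mod_cast hm
        rw [hNN]
        push_cast
        rw [div_le_div_iff₀ (by positivity) (by positivity)]
        nlinarith
      have : 9 / (N : ℝ) + 2 * (3 / N) ≤ 18 / N := by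
        rw [← mul_div_assoc, ← add_div]; gcongr; norm_num
      linarith
    have hRe : 18 / (N : ℝ) ≤ ε := by
      rw [div_le_iff₀ hε.1] at hNε
      rw [div_le_iff₀ hNp]; linarith
    calc _ ≤ 1 / (n : ℝ) * (n * R) := by gcongr
      _ = R := by field_simp
      _ ≤ 2 * ε := by linarith [hε.1]
end
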